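/- Let $p_1,\ldots,p_n$ be functions analytic at $0$ with $p_i(0)\ne 0$. Define the $n\times n$ matrix $S(i,j) = \frac{1}{2\pi i}\oint_0 v^{i-j-1} p_i(v)\,dv$ (the coefficient of $v^{j-i}$ in the Taylor expansion of $p_i$ at $0$), and the matrix $W(i,j) = \oint \frac{dv_1}{2\pi i}\cdots\oint \frac{dv_j}{2\pi i}\; \frac{v_1^{i-1}}{\left[\prod_{\ell=1}^{j-1}(v_\ell - v_{\ell+1})\right]\cdot\left[\prod_{\ell=1}^{j} v_\ell P_\ell(v_\ell)\right]}$, where $P_1 = p_1$, $P_i = p_i/p_{i-1}$ for $2\le i\le n$, and the contours are nested small circles around the origin with $|v_1| > |v_2| > \cdots > |v_j|$. Then $SW = I$, i.e., $W = S^{-1}$. -/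

import Mathlib

open Finset

/-- `(2πi)⁻¹ ∮_{|v|=r} f(v) dv`. -/
noncomputable def cInt (r : ℝ) (f : ℂ → ℂ) : ℂ :=
  (2 * Real.pi * Complex.I)⁻¹ * ∮ v in C(0, r), f v

/-- Iterated (nested) contour integrals: `j` counterclockwise circles around `0` of radii
`r 0 > r 1 > ⋯ > r (j-1)`, the variable `v k` running over the circle of radius `r k`,
each integral carrying the factor `(2πi)⁻¹`. -/
noncomputable def nestedCI : ℕ → (ℕ → ℝ) → ((ℕ → ℂ) → ℂ) → ℂ
  | 0, _, F => F fun _ => 0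
  | j+1, r, F => cInt (r 0) fun v =>
      nestedCI j (fun k => r (k+1)) fun w => F fun k => match k with
        | 0 => v
        | k+1 => w k

/-- The Taylor series at `0` of a function `f : ℂ → ℂ`. -/
noncomputable def taylorSeries (f : ℂ → ℂ) : PowerSeries ℂ :=
  PowerSeries.mk fun k => iteratedDeriv k f 0 / (k.factorial : ℂ)

lemma taylorSeries_mul {f g : ℂ → ℂ} (hf : AnalyticAt ℂ f 0) (hg : AnalyticAt ℂ g 0) :
    taylorSeries (f * g) = taylorSeries f * taylorSeries g := by
  ext k
  rw [PowerSeries.coeff_mul, Finset.Nat.sum_antidiagonal_eq_sum_range_succ_mk]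
  simp only [taylorSeries, PowerSeries.coeff_mk]
  rw [iteratedDeriv_mul hf.contDiffAt hg.contDiffAt, Finset.sum_div]
  refine Finset.sum_congr rfl fun i hi => ?_
  have hik : i ≤ k := Nat.lt_succ_iff.mp (Finset.mem_range.mp hi)
  rw [Nat.cast_choose ℂ hik]
  have := Nat.factorial_ne_zero k
  have := Nat.factorial_ne_zero i
  have := Nat.factorial_ne_zero (k - i)
  field_simp

lemma taylorSeries_congr {f g : ℂ → ℂ} (h : f =ᶠ[nhds 0] g) :
    taylorSeries f = taylorSeries g := by
  ext k
  rw [taylorSeries, taylorSeries, PowerSeries.coeff_mk, PowerSeries.coeff_mk,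
    h.iteratedDeriv_eq k]

lemma taylorSeries_one : taylorSeries (1 : ℂ → ℂ) = 1 := by
  ext k
  have h : iteratedDeriv k (1 : ℂ → ℂ) 0 = if k = 0 then 1 else 0 :=
    iteratedDeriv_const
  rw [taylorSeries, PowerSeries.coeff_mk, h, PowerSeries.coeff_one]
  split_ifs with hk <;> simp [hk]

lemma taylorSeries_id : taylorSeries id = PowerSeries.X := by
  ext k
  rw [taylorSeries, PowerSeries.coeff_mk, PowerSeries.coeff_X]
  rcases k with _ | k
  · simp
  · have : deriv (id : ℂ → ℂ) = fun _ => 1 := by ext; simp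
    rw [iteratedDeriv_succ', this, iteratedDeriv_const]
    rcases k with _ | k <;> simp

lemma taylorSeries_id_pow (k : ℕ) : taylorSeries (id ^ k) = PowerSeries.X ^ k := by
  induction k with
  | zero => simpa using taylorSeries_one
  | succ k ih =>
    rw [pow_succ, taylorSeries_mul (analyticAt_id.pow k) analyticAt_id, ih, taylorSeries_id,
      pow_succ]

lemma coeff_taylorSeries_const_sub_inv {z : ℂ} (hz : z ≠ 0) (k : ℕ) :
    PowerSeries.coeff k (taylorSeries fun w => (z - w)⁻¹) = (z ^ (k + 1))⁻¹ := by
  have h : iteratedDeriv k (fun w : ℂ => (z - w)⁻¹) 0 = k.factorial * (z ^ (k + 1))⁻¹ := by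
    have h := iter_deriv_inv_linear_sub k (-1 : ℂ) (-z)
    have e : (fun w : ℂ => (z - w)⁻¹) = fun x => (-1 * x - -z)⁻¹ := by
      ext w; congr 1; ring
    rw [iteratedDeriv_eq_iterate, e, h]
    beta_reduce
    have h1 : ((-1 : ℂ) ^ k) * (-1) ^ k = 1 := by rw [← mul_pow]; simp
    have h2 : (-1 * (0 : ℂ) - -z) ^ (-1 - (k : ℤ)) = (z ^ (k + 1))⁻¹ := by
      rw [← zpow_natCast, ← zpow_neg]
      congr 1
      · ring
      · push_cast; ring
    rw [h2]
    linear_combination (k.factorial : ℂ) * (z ^ (k + 1))⁻¹ * h1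
  have := Nat.factorial_ne_zero k
  rw [taylorSeries, PowerSeries.coeff_mk, h]
  field_simp

lemma cInt_congr {r : ℝ} (hr : 0 < r) {f g : ℂ → ℂ} (h : ∀ v, ‖v‖ = r → f v = g v) :
    cInt r f = cInt r g := by
  rw [cInt, cInt, circleIntegral.integral_congr hr.le fun v hv => h v (by simpa using hv)]

lemma cInt_const_mul (r : ℝ) (c : ℂ) (f : ℂ → ℂ) :
    cInt r (fun v => c * f v) = c * cInt r f := by
  rw [cInt, cInt, circleIntegral.integral_const_mul]
  ring

lemma cInt_sum {r : ℝ} (hr : 0 < r) {ι : Type*} (s : Finset ι) (f : ι → ℂ → ℂ)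
    (hf : ∀ i ∈ s, ContinuousOn (f i) (Metric.sphere 0 r)) :
    cInt r (fun v => ∑ i ∈ s, f i v) = ∑ i ∈ s, cInt r (f i) := by
  simp only [cInt]
  rw [circleIntegral.integral_fun_sum fun i hi => (hf i hi).circleIntegrable hr.le,
    Finset.mul_sum]

lemma cInt_div_pow_succ {r : ℝ} (hr : 0 < r) {f : ℂ → ℂ}
    (hf : AnalyticOnNhd ℂ f (Metric.closedBall 0 r)) (k : ℕ) :
    cInt r (fun v => f v / v ^ (k + 1)) = PowerSeries.coeff k (taylorSeries f) := by
  have hd : DiffContOnCl ℂ f (Metric.ball 0 r) :=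
    hf.differentiableOn.diffContOnCl_ball subset_rfl
  have h := hd.circleIntegral_one_div_sub_center_pow_smul hr k
  simp only [sub_zero, smul_eq_mul, one_div_mul_eq_div] at h
  rw [cInt, h, taylorSeries, PowerSeries.coeff_mk]
  have := Complex.two_pi_I_ne_zero
  have := Nat.factorial_ne_zero k
  field_simp

lemma nestedCI_const_mul (j : ℕ) (ρ : ℕ → ℝ) (c : ℂ) (F : (ℕ → ℂ) → ℂ) :
    nestedCI j ρ (fun v => c * F v) = c * nestedCI j ρ F := by
  induction j generalizing ρ F with
  | zero => rfl
  | succ j ih => simp only [nestedCI, ih, cInt_const_mul]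

/-- Removal of the constant term followed by division by `X`. -/
noncomputable def shiftDown : PowerSeries ℂ →ₗ[ℂ] PowerSeries ℂ where
  toFun φ := PowerSeries.mk fun k => PowerSeries.coeff (k + 1) φ
  map_add' φ ψ := by ext; simp
  map_smul' c φ := by ext; simp

@[simp]
lemma coeff_shiftDown (φ : PowerSeries ℂ) (k : ℕ) :
    PowerSeries.coeff k (shiftDown φ) = PowerSeries.coeff (k + 1) φ := by
  simp [shiftDown]

@[simp]
lemma shiftDown_X_mul (φ : PowerSeries ℂ) : shiftDown (PowerSeries.X * φ) = φ := by
  ext; simp [PowerSeries.coeff_succ_X_mul]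

@[simp]
lemma shiftDown_one : shiftDown 1 = 0 := by
  ext; simp [PowerSeries.coeff_one]

/-- The functional on power series computed by the nested contour integrals: multiply by `u 0`,
apply `shiftDown`, multiply by `u 1`, apply `shiftDown`, ..., multiply by `u j`, and evaluate
at `0`. -/
noncomputable def iterShift : ℕ → (ℕ → PowerSeries ℂ) → PowerSeries ℂ →ₗ[ℂ] ℂ
  | 0, u => PowerSeries.coeff 0 ∘ₗ LinearMap.mulRight ℂ (u 0)
  | j + 1, u => iterShift j (fun k => u (k + 1)) ∘ₗ shiftDown ∘ₗ LinearMap.mulRight ℂ (u 0)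

lemma iterShift_zero_apply (u : ℕ → PowerSeries ℂ) (φ : PowerSeries ℂ) :
    iterShift 0 u φ = PowerSeries.coeff 0 (φ * u 0) := rfl

lemma iterShift_succ_apply (j : ℕ) (u : ℕ → PowerSeries ℂ) (φ : PowerSeries ℂ) :
    iterShift (j + 1) u φ = iterShift j (fun k => u (k + 1)) (shiftDown (φ * u 0)) := rfl

lemma iterShift_X_pow_mul {j m : ℕ} (hm : j < m) (u : ℕ → PowerSeries ℂ) (φ : PowerSeries ℂ) :
    iterShift j u (PowerSeries.X ^ m * φ) = 0 := by
  induction j generalizing m u φ with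
  | zero =>
    obtain ⟨m, rfl⟩ := Nat.exists_eq_succ_of_ne_zero hm.ne'
    simp [iterShift_zero_apply]
  | succ j ih =>
    obtain ⟨m, rfl⟩ := Nat.exists_eq_succ_of_ne_zero (Nat.ne_zero_of_lt hm)
    rw [iterShift_succ_apply, pow_succ', mul_assoc, mul_assoc, shiftDown_X_mul]
    exact ih (Nat.lt_of_succ_lt_succ hm) _ _

lemma sum_coeff_mul_iterShift_X_pow {j m : ℕ} (hm : j < m) (u : ℕ → PowerSeries ℂ)
    (φ : PowerSeries ℂ) :
    ∑ k ∈ Finset.range m, PowerSeries.coeff k φ * iterShift j u (PowerSeries.X ^ k) =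
      iterShift j u φ := by
  conv_rhs => rw [PowerSeries.eq_X_pow_mul_shift_add_trunc m φ, map_add,
    iterShift_X_pow_mul hm, zero_add]
  have h : ((PowerSeries.trunc m φ : Polynomial ℂ) : PowerSeries ℂ) =
      ∑ k ∈ Finset.range m, PowerSeries.coeff k φ • (PowerSeries.X : PowerSeries ℂ) ^ k := by
    ext k
    simp [Polynomial.coeff_coe, PowerSeries.coeff_trunc, PowerSeries.coeff_X_pow]
  rw [h, map_sum]
  simp

lemma iterShift_X_pow_mul_eq_ite (i j : ℕ) (u b : ℕ → PowerSeries ℂ) (d : PowerSeries ℂ)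
    (hd : d * b 0 = 1) (hu : ∀ ℓ ≤ j, u ℓ * b (ℓ + 1) = b ℓ) :
    iterShift j u (PowerSeries.X ^ i * b (i + 1) * d) = if i = j then 1 else 0 := by
  have h1 : d * u 0 * b 1 = 1 := by rw [mul_assoc, hu 0 (Nat.zero_le _), hd]
  induction j generalizing i u b d with
  | zero =>
    rw [iterShift_zero_apply]
    rcases i with _ | i
    · rw [pow_zero, one_mul, show b (0 + 1) * d * u 0 = 1 by rw [← h1]; ring]
      simp
    · rw [pow_succ', mul_assoc, mul_assoc, mul_assoc]
      simp
  | succ j ih =>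
    rw [iterShift_succ_apply]
    rcases i with _ | i
    · rw [pow_zero, one_mul, show b (0 + 1) * d * u 0 = 1 by rw [← h1]; ring]
      simp
    · rw [show PowerSeries.X ^ (i + 1) * b (i + 1 + 1) * d * u 0 =
        PowerSeries.X * (PowerSeries.X ^ i * b (i + 1 + 1) * (d * u 0)) by ring,
        shiftDown_X_mul]
      have hu' : ∀ ℓ ≤ j, u (ℓ + 1) * b (ℓ + 1 + 1) = b (ℓ + 1) :=
        fun ℓ hℓ => hu (ℓ + 1) (Nat.succ_le_succ hℓ)
      have := ih i (fun k => u (k + 1)) (fun k => b (k + 1)) (d * u 0) h1 hu'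
        (by rw [mul_assoc, hu' 0 (Nat.zero_le _), h1])
      simpa using this

lemma nestedCI_eq_iterShift (j : ℕ) (ρ : ℕ → ℝ) (hρ : ∀ k, 0 < ρ k)
    (hρdec : ∀ k, ρ (k + 1) < ρ k) (P : ℕ → ℂ → ℂ)
    (hP : ∀ ℓ ≤ j, AnalyticOnNhd ℂ (P ℓ)⁻¹ (Metric.closedBall 0 (ρ 0)))
    (f : ℂ → ℂ) (hf : AnalyticOnNhd ℂ f (Metric.closedBall 0 (ρ 0))) :
    nestedCI (j + 1) ρ (fun v => f (v 0) / ((∏ ℓ ∈ Finset.range j, (v ℓ - v (ℓ + 1))) *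
        ∏ ℓ ∈ Finset.range (j + 1), (v ℓ * P ℓ (v ℓ)))) =
      iterShift j (fun ℓ => taylorSeries (P ℓ)⁻¹) (taylorSeries f) := by
  have h0 : (0 : ℂ) ∈ Metric.closedBall (0 : ℂ) (ρ 0) := by simpa using (hρ 0).le
  have hfP : AnalyticOnNhd ℂ (f * (P 0)⁻¹) (Metric.closedBall 0 (ρ 0)) :=
    hf.mul (hP 0 (Nat.zero_le _))
  have hts : taylorSeries f * taylorSeries (P 0)⁻¹ = taylorSeries (f * (P 0)⁻¹) :=
    (taylorSeries_mul (hf 0 h0) (hP 0 (Nat.zero_le _) 0 h0)).symm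
  induction j generalizing ρ P f with
  | zero =>
    rw [iterShift_zero_apply, hts, ← cInt_div_pow_succ (hρ 0) hfP]
    simp only [nestedCI]
    congr 1
    ext v
    simp [div_eq_mul_inv]
    ring
  | succ j ih =>
    rw [iterShift_succ_apply, hts,
      ← sum_coeff_mul_iterShift_X_pow (Nat.lt_succ_self j)]
    simp only [coeff_shiftDown]
    set c : ℕ → ℂ := fun k => iterShift j (fun ℓ => taylorSeries (P (ℓ + 1))⁻¹)
      (PowerSeries.X ^ k)
    have hsub : Metric.closedBall (0 : ℂ) (ρ 1) ⊆ Metric.closedBall 0 (ρ 0) :=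
      Metric.closedBall_subset_closedBall (hρdec 0).le
    have h1 : (0 : ℂ) ∈ Metric.closedBall (0 : ℂ) (ρ 1) := by simpa using (hρ 1).le
    have hP' : ∀ ℓ ≤ j, AnalyticOnNhd ℂ (P (ℓ + 1))⁻¹ (Metric.closedBall 0 (ρ 1)) :=
      fun ℓ hℓ => (hP (ℓ + 1) (Nat.succ_le_succ hℓ)).mono hsub
    have key : ∀ z : ℂ, ‖z‖ = ρ 0 →
        nestedCI (j + 1) (fun k => ρ (k + 1)) (fun w => (z - w 0)⁻¹ /
          ((∏ ℓ ∈ Finset.range j, (w ℓ - w (ℓ + 1))) *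
            ∏ ℓ ∈ Finset.range (j + 1), (w ℓ * P (ℓ + 1) (w ℓ)))) =
          ∑ k ∈ Finset.range (j + 1), (z ^ (k + 1))⁻¹ * c k := by
      intro z hz
      have hz0 : z ≠ 0 := norm_pos_iff.mp (hz ▸ hρ 0)
      have ha : AnalyticOnNhd ℂ (fun w : ℂ => (z - w)⁻¹) (Metric.closedBall 0 (ρ 1)) := by
        intro w hw
        refine (analyticAt_const.sub analyticAt_id).inv (sub_ne_zero.mpr ?_)
        intro hzw
        have hle : ‖w‖ ≤ ρ 1 := by simpa using hw
        rw [show w = z from hzw.symm, hz] at hle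
        linarith [hρdec 0]
      rw [ih (fun k => ρ (k + 1)) (fun k => hρ _) (fun k => hρdec _) (fun ℓ => P (ℓ + 1)) hP'
        (fun w => (z - w)⁻¹) ha h1 (ha.mul (hP' 0 (Nat.zero_le _)))
        (taylorSeries_mul (ha 0 h1) (hP' 0 (Nat.zero_le _) 0 h1)).symm,
        ← sum_coeff_mul_iterShift_X_pow (Nat.lt_succ_self j)]
      exact Finset.sum_congr rfl fun k _ => by rw [coeff_taylorSeries_const_sub_inv hz0]
    have step : nestedCI (j + 1 + 1) ρ (fun v => f (v 0) /
        ((∏ ℓ ∈ Finset.range (j + 1), (v ℓ - v (ℓ + 1))) *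
          ∏ ℓ ∈ Finset.range (j + 1 + 1), (v ℓ * P ℓ (v ℓ)))) =
        cInt (ρ 0) fun z => ∑ k ∈ Finset.range (j + 1),
          c k * ((f * (P 0)⁻¹) z / z ^ (k + 1 + 1)) := by
      rw [nestedCI]
      refine cInt_congr (hρ 0) fun z hz => ?_
      have hsum : ∑ k ∈ Finset.range (j + 1), c k * ((f * (P 0)⁻¹) z / z ^ (k + 1 + 1)) =
          (f z / (z * P 0 z)) * ∑ k ∈ Finset.range (j + 1), (z ^ (k + 1))⁻¹ * c k := by
        rw [Finset.mul_sum]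
        refine Finset.sum_congr rfl fun k _ => ?_
        simp only [Pi.mul_apply, Pi.inv_apply, div_eq_mul_inv, mul_inv, pow_succ _ (k + 1)]
        ring
      rw [hsum, ← key z hz, ← nestedCI_const_mul]
      congr 1
      ext w
      rw [Finset.prod_range_succ', Finset.prod_range_succ' _ (j + 1)]
      simp only [div_eq_mul_inv, mul_inv]
      ring
    rw [step, cInt_sum (hρ 0)]
    · refine Finset.sum_congr rfl fun k _ => ?_
      rw [cInt_const_mul, cInt_div_pow_succ (hρ 0) hfP, mul_comm]
    · intro k _
      refine continuousOn_const.mul (ContinuousOn.div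
        (hfP.continuousOn.mono Metric.sphere_subset_closedBall)
        (continuous_pow _).continuousOn fun z hz => pow_ne_zero _ ?_)
      exact norm_pos_iff.mp ((mem_sphere_zero_iff_norm.mp hz) ▸ hρ 0)

/-- Lemma 4.1: `S(i,j) = (2πi)⁻¹∮ v^{i-j-1} pᵢ(v) dv` and
`W(i,j) = ∮⋯∮ v₁^{i-1} / ([∏(v_ℓ-v_{ℓ+1})]·[∏ v_ℓ P_ℓ(v_ℓ)])` over nested small circles
`|v₁|>⋯>|v_j|`, with `P₁ = p₁`, `P_ℓ = p_ℓ/p_{ℓ-1}`.  Then `S W = I`.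
Indices are `0`-based: `p ℓ`, `P ℓ` play the roles of `p_{ℓ+1}`, `P_{ℓ+1}`, and
`i j : Fin n` the roles of `i+1, j+1` (so `W(i,j)` has `j+1` integration variables and the
numerator is `v₁^i`). -/
theorem stmt2 (n : ℕ) (p P : ℕ → ℂ → ℂ) (R₀ : ℝ) (hR₀ : 0 < R₀)
    (hp : ∀ i < n, ∀ v ∈ Metric.closedBall (0 : ℂ) R₀, AnalyticAt ℂ (p i) v)
    (hp0 : ∀ i < n, p i 0 ≠ 0)
    (hpne : ∀ i < n, ∀ v ∈ Metric.closedBall (0 : ℂ) R₀, p i v ≠ 0)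
    (hP0 : ∀ v, P 0 v = p 0 v)
    (hPs : ∀ ℓ, 0 < ℓ → ∀ v, P ℓ v = p ℓ v / p (ℓ - 1) v)
    (S W : Matrix (Fin n) (Fin n) ℂ)
    (r : ℝ) (hr : 0 < r) (hrR : r < R₀)
    (hS : ∀ i j, S i j = cInt r (fun v => v ^ ((i : ℤ) - (j : ℤ) - 1) * p i v))
    (ρ : ℕ → ℝ) (hρpos : ∀ k, 0 < ρ k) (hρR : ∀ k, ρ k < R₀) (hρdec : ∀ k, ρ (k+1) < ρ k)
    (hW : ∀ i j, W i j = nestedCI ((j : ℕ) + 1) ρ (fun v =>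
      v 0 ^ (i : ℕ) / ((∏ ℓ ∈ Finset.range (j : ℕ), (v ℓ - v (ℓ+1))) *
        ∏ ℓ ∈ Finset.range ((j : ℕ) + 1), (v ℓ * P ℓ (v ℓ))))) :
    S * W = 1 := by
  obtain ⟨b, hb⟩ : ∃ b : ℕ → PowerSeries ℂ, b = fun ℓ => match ℓ with
    | 0 => 1
    | ℓ + 1 => taylorSeries (p ℓ) := ⟨_, rfl⟩
  have h0 : (0 : ℂ) ∈ Metric.closedBall (0 : ℂ) R₀ := by simpa using hR₀.le
  have hball : ∀ s < R₀, Metric.closedBall (0 : ℂ) s ⊆ Metric.closedBall 0 R₀ :=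
    fun s hs => Metric.closedBall_subset_closedBall hs.le
  have hPfun : ∀ ℓ, P (ℓ + 1) = p (ℓ + 1) / p ℓ := fun ℓ => funext fun v => by
    simpa using hPs (ℓ + 1) ℓ.succ_pos v
  have hPinv : ∀ ℓ < n, AnalyticOnNhd ℂ (P ℓ)⁻¹ (Metric.closedBall 0 R₀) := by
    intro ℓ hℓ v hv
    rcases ℓ with _ | ℓ
    · rw [show P 0 = p 0 from funext hP0]
      exact (hp 0 hℓ v hv).inv (hpne 0 hℓ v hv)
    · rw [hPfun, inv_div]
      exact (hp ℓ (Nat.lt_of_succ_lt hℓ) v hv).div (hp _ hℓ v hv) (hpne _ hℓ v hv)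
  have hu : ∀ ℓ < n, taylorSeries (P ℓ)⁻¹ * b (ℓ + 1) = b ℓ := by
    intro ℓ hℓ
    have hmul : taylorSeries (P ℓ)⁻¹ * b (ℓ + 1) = taylorSeries ((P ℓ)⁻¹ * p ℓ) := by
      rw [hb, taylorSeries_mul (hPinv ℓ hℓ 0 h0) (hp ℓ hℓ 0 h0)]
    have hev : ∀ᶠ v in nhds (0 : ℂ), p ℓ v ≠ 0 :=
      (hp ℓ hℓ 0 h0).continuousAt.eventually_ne (hp0 ℓ hℓ)
    rw [hmul]
    rcases ℓ with _ | ℓ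
    · rw [show P 0 = p 0 from funext hP0, hb]
      refine (taylorSeries_congr ?_).trans taylorSeries_one
      filter_upwards [hev] with v hv
      simp [hv]
    · rw [hPfun, hb]
      refine taylorSeries_congr ?_
      filter_upwards [hev] with v hv
      simp [hv]
  have hSc : ∀ i k, S i k = PowerSeries.coeff (k : ℕ) (PowerSeries.X ^ (i : ℕ) * b (i + 1)) := by
    intro i k
    have hpi : AnalyticOnNhd ℂ (p i) (Metric.closedBall 0 R₀) := hp i i.2
    have ha : AnalyticOnNhd ℂ (id ^ (i : ℕ) * p i) (Metric.closedBall 0 R₀) :=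
      (analyticOnNhd_id.pow _).mul hpi
    have hX : PowerSeries.X ^ (i : ℕ) * b (i + 1) = taylorSeries (id ^ (i : ℕ) * p i) := by
      rw [taylorSeries_mul (analyticAt_id.pow _) (hpi 0 h0), taylorSeries_id_pow, hb]
    rw [hS, hX, ← cInt_div_pow_succ hr (ha.mono (hball r hrR))]
    refine cInt_congr hr fun v hv => ?_
    have hv0 : v ≠ 0 := norm_pos_iff.mp (hv ▸ hr)
    have hz : v ^ ((i : ℤ) - (k : ℤ) - 1) = v ^ (i : ℕ) / v ^ ((k : ℕ) + 1) := by
      rw [sub_sub, zpow_sub₀ hv0]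
      norm_cast
    simp only [Pi.mul_apply, Pi.pow_apply, id]
    rw [hz]
    ring
  have hWc : ∀ k j, W k j =
      iterShift j (fun ℓ => taylorSeries (P ℓ)⁻¹) (PowerSeries.X ^ (k : ℕ)) := by
    intro k j
    rw [hW, ← taylorSeries_id_pow]
    have h := nestedCI_eq_iterShift j ρ hρpos hρdec P
      (fun ℓ hℓ => (hPinv ℓ (hℓ.trans_lt j.2)).mono (hball _ (hρR 0))) (id ^ (k : ℕ))
      (analyticOnNhd_id.pow _)
    simpa only [Pi.pow_apply, id] using h
  ext i j
  simp only [Matrix.mul_apply, hSc, hWc]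
  rw [Fin.sum_univ_eq_sum_range (fun k => PowerSeries.coeff k
    (PowerSeries.X ^ (i : ℕ) * b (i + 1)) *
      iterShift j (fun ℓ => taylorSeries (P ℓ)⁻¹) (PowerSeries.X ^ k)) n,
    sum_coeff_mul_iterShift_X_pow j.2]
  have h := iterShift_X_pow_mul_eq_ite i j (fun ℓ => taylorSeries (P ℓ)⁻¹) b 1
    (by rw [hb, one_mul]) fun ℓ hℓ => hu ℓ (hℓ.trans_lt j.2)
  rw [mul_one] at h
  rw [h, Matrix.one_apply]
  simp only [Fin.ext_iff]
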